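/- arXiv:2506.00948 — 5 statements merged into one kernel-verified Lean document; each statement's English description precedes it below -/
import Mathlib

section
/- Let d ≥ 1 and let Σ be a finite nonempty subset of GL_d(ℤ) such that no matrix of Σ has its inverse also in Σ, and suppose the subgroup H = ⟨Σ⟩ generated by Σ is infinite. Then there exists a constant C > 0 such that for every n ≥ 2, the number of words w of length n over the alphabet Σ̃ = Σ ∪ Σ⁻¹ whose product M(w) reduces to the identity matrix modulo q(n) is at most C · |Σ̃|ⁿ / (log n)². Equivalently, if w is chosen uniformly at random among the length-n words over Σ̃, then the probability that M(w) ≡ Id (mod q(n)) is O((log n)⁻²). -/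
open Matrix

/-- `q n` is the product of all primes `p ≤ (log₂ n)^5` (and `q 0 = q 1 = 1`). -/
noncomputable def qfun (n : ℕ) : ℕ :=
  ∏ p ∈ Finset.filter Nat.Prime (Finset.range (⌊(Real.logb 2 n) ^ 5⌋₊ + 1)), p

open Finset in
open scoped Pointwise in
/-- If a finite symmetric set generates an infinite group, the `r`-th power of `T * T` has at least
`r + 1` elements. -/
theorem succ_le_card_mul_self_pow {G : Type*} [Group G] [DecidableEq G] (T : Finset G)
    (hT : ∀ t ∈ T, t⁻¹ ∈ T) (hne : T.Nonempty)
    (hinf : (Subgroup.closure (T : Set G) : Set G).Infinite) (r : ℕ) :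
    r + 1 ≤ ((T * T) ^ r).card := by
  obtain ⟨t₀, ht₀⟩ := hne
  have one_mem : (1 : G) ∈ T * T := by
    simpa using mul_mem_mul ht₀ (hT _ ht₀)
  induction r with
  | zero => simp
  | succ r ih =>
    by_contra! hlt
    have hsub : (T * T) ^ r ⊆ (T * T) ^ (r + 1) := pow_subset_pow_right one_mem (Nat.le_succ r)
    have heq : (T * T) ^ r = (T * T) ^ (r + 1) := eq_of_subset_of_card_le hsub (by lia)
    set K := (T * T) ^ r with hK
    have hmul : ∀ x ∈ K, ∀ s ∈ T, ∀ t ∈ T, x * (s * t) ∈ K := by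
      intro x hx s hs t ht
      rw [heq, pow_succ]
      exact mul_mem_mul hx (mul_mem_mul hs ht)
    have hstep : ∀ x, (x ∈ K ∨ x * t₀ ∈ K) → ∀ t ∈ T, (x * t ∈ K ∨ x * t * t₀ ∈ K) := by
      rintro x (hx | hx) t ht
      · right
        simpa [mul_assoc] using hmul x hx t ht t₀ ht₀
      · left
        simpa [mul_assoc] using hmul _ hx t₀⁻¹ (hT _ ht₀) t ht
    refine hinf (Set.Finite.subset (K.finite_toSet.union
      (K.image fun x => x * t₀⁻¹).finite_toSet) ?_)
    intro x hx
    have key : x ∈ K ∨ x * t₀ ∈ K := by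
      induction hx using Subgroup.closure_induction_right with
      | one => exact Or.inl (one_mem_pow one_mem)
      | mul_right x _ y hy ih => exact hstep x ih y hy
      | mul_inv_cancel x _ y hy ih => exact hstep x ih _ (hT y hy)
    rcases key with h | h
    · exact Or.inl h
    · right
      simp only [coe_image, Set.mem_image, mem_coe]
      exact ⟨_, h, by simp⟩

open Finset in
/-- The variance of a finite family controls each difference of its values. -/
theorem sub_sq_le_card_mul_sum_sq_sub_sq_sum {T : Type*} [Fintype T] (a : T → ℝ) (s t : T) :
    (a s - a t) ^ 2 ≤ 2 * (Fintype.card T * ∑ i, a i ^ 2 - (∑ i, a i) ^ 2) := by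
  have hexp : ∑ i, ∑ j, (a i - a j) ^ 2
      = 2 * (Fintype.card T * ∑ i, a i ^ 2 - (∑ i, a i) ^ 2) := by
    simp_rw [sub_sq, sum_add_distrib, sum_sub_distrib, mul_assoc, ← mul_sum, ← sum_mul]
    simp [← mul_sum]
    ring
  rw [← hexp]
  calc (a s - a t) ^ 2 ≤ ∑ j, (a s - a j) ^ 2 :=
        single_le_sum (f := fun j => (a s - a j) ^ 2) (fun _ _ => sq_nonneg _) (mem_univ t)
    _ ≤ _ := single_le_sum (f := fun i => ∑ j, (a i - a j) ^ 2)
        (fun _ _ => sum_nonneg fun _ _ => sq_nonneg _) (mem_univ s)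

/-- One step of the random walk with increments `φ t`, `t` uniform, acting on functions. -/
noncomputable def walkAverage {G T : Type*} [Mul G] [Fintype T] (φ : T → G) (f : G → ℝ) (x : G) :
    ℝ :=
  (∑ t, f (x * φ t)) / Fintype.card T

section WalkAverage

open Finset

variable {G T : Type*} [Group G] (φ : T → G)

open scoped Pointwise in
theorem abs_sub_mul_pow_le [DecidableEq G] {φ : T → G} {D : Finset G}
    (hD : ∀ g ∈ D, ∃ s t, g = (φ s)⁻¹ * φ t) {f : G → ℝ} {δ : ℝ}
    (hf : ∀ x s t, |f (x * φ s) - f (x * φ t)| ≤ δ) (r : ℕ) :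
    ∀ g ∈ D ^ r, ∀ x, |f x - f (x * g)| ≤ r * δ := by
  induction r with
  | zero => simp
  | succ r ih =>
    intro g hg x
    rw [pow_succ] at hg
    obtain ⟨h, hh, e, he, rfl⟩ := mem_mul.1 hg
    obtain ⟨s, t, rfl⟩ := hD e he
    have h1 := ih h hh x
    have h2 := hf (x * h * (φ s)⁻¹) s t
    simp only [inv_mul_cancel_right] at h2
    have h3 := abs_sub_le (f x) (f (x * h)) (f (x * (h * ((φ s)⁻¹ * φ t))))
    simp only [mul_assoc] at h1 h2 h3 ⊢
    push_cast
    linarith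

variable [Fintype T]

theorem walkAverage_nonneg {f : G → ℝ} (hf : ∀ x, 0 ≤ f x) (x : G) : 0 ≤ walkAverage φ f x :=
  div_nonneg (sum_nonneg fun _ _ => hf _) (Nat.cast_nonneg _)

variable [Nonempty T]

theorem walkAverage_le {f : G → ℝ} {M : ℝ} (hf : ∀ x, f x ≤ M) (x : G) :
    walkAverage φ f x ≤ M := by
  have hk : (0 : ℝ) < Fintype.card T := by exact_mod_cast Fintype.card_pos
  rw [walkAverage, div_le_iff₀ hk, mul_comm]
  simpa using sum_le_card_nsmul univ (fun t => f (x * φ t)) M fun t _ => hf _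

/-- Words of length `n` with product `x⁻¹` are counted by the `n`-step random walk. -/
theorem card_words_prod_eq [DecidableEq G] (n : ℕ) (x : G) :
    (Nat.card {w : Fin n → T // (List.ofFn fun i => φ (w i)).prod = x⁻¹} : ℝ) =
      Fintype.card T ^ n * (walkAverage φ)^[n] (Pi.single 1 1) x := by
  have hk : (Fintype.card T : ℝ) ≠ 0 := by simp
  induction n generalizing x with
  | zero =>
    by_cases hx : x = 1
    · subst hx; simp
    · simp [hx, eq_comm]
  | succ n ih =>
    have e : {w : Fin (n + 1) → T // (List.ofFn fun i => φ (w i)).prod = x⁻¹} ≃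
        Σ t : T, {w : Fin n → T // (List.ofFn fun i => φ (w i)).prod = (x * φ t)⁻¹} :=
      { toFun := fun w => ⟨w.1 0, fun i => w.1 i.succ, by
          have h := w.2
          rw [List.ofFn_succ, List.prod_cons] at h
          simp [_root_.mul_inv_rev, ← h]⟩
        invFun := fun p => ⟨Fin.cons p.1 p.2.1, by
          rw [List.ofFn_succ, List.prod_cons]
          simp [p.2.2]⟩
        left_inv := fun w => Subtype.ext (Fin.cons_self_tail w.1)
        right_inv := fun p => rfl }
    rw [Nat.card_congr e, Nat.card_sigma, Nat.cast_sum, Function.iterate_succ_apply', walkAverage]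
    simp_rw [ih, ← mul_sum]
    field_simp
    ring

variable [Fintype G]

theorem sum_walkAverage (f : G → ℝ) : ∑ x, walkAverage φ f x = ∑ x, f x := by
  have hk : (Fintype.card T : ℝ) ≠ 0 := by simp
  simp only [walkAverage]
  rw [← sum_div, sum_comm, div_eq_iff hk]
  calc ∑ t, ∑ x, f (x * φ t) = ∑ _t : T, ∑ x, f x :=
        sum_congr rfl fun t _ => Equiv.sum_comp (Equiv.mulRight (φ t)) f
    _ = _ := by simp [mul_comm]

theorem sub_sq_le_sum_sq_sub_sum_walkAverage_sq (f : G → ℝ) (x : G) (s t : T) :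
    (f (x * φ s) - f (x * φ t)) ^ 2 ≤
      2 * Fintype.card T ^ 2 * (∑ y, f y ^ 2 - ∑ y, walkAverage φ f y ^ 2) := by
  have hk : (0 : ℝ) < Fintype.card T := by exact_mod_cast Fintype.card_pos
  have hsum : 2 * (Fintype.card T : ℝ) ^ 2 * (∑ y, f y ^ 2 - ∑ y, walkAverage φ f y ^ 2) =
      ∑ y, 2 * (Fintype.card T * ∑ i, f (y * φ i) ^ 2 - (∑ i, f (y * φ i)) ^ 2) := by
    rw [← sum_walkAverage φ fun y => f y ^ 2, ← sum_sub_distrib, mul_sum]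
    refine sum_congr rfl fun y _ => ?_
    simp only [walkAverage]
    field_simp
  rw [hsum]
  calc _ ≤ 2 * (Fintype.card T * ∑ i, f (x * φ i) ^ 2 - (∑ i, f (x * φ i)) ^ 2) :=
        sub_sq_le_card_mul_sum_sq_sub_sq_sum (fun i => f (x * φ i)) s t
    _ ≤ _ := single_le_sum
        (f := fun y => 2 * (Fintype.card T * ∑ i, f (y * φ i) ^ 2 - (∑ i, f (y * φ i)) ^ 2))
        (fun y _ => (sq_nonneg _).trans
          (sub_sq_le_card_mul_sum_sq_sub_sq_sum (fun i => f (y * φ i)) s s)) (mem_univ x)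

open scoped Pointwise in
/-- Pointwise bound for the law of a random walk on a finite group. -/
theorem walkAverage_iterate_le [DecidableEq G] {D : Finset G}
    (hD : ∀ g ∈ D, ∃ s t, g = (φ s)⁻¹ * φ t) (hDne : D.Nonempty) (n r : ℕ) (hn : 0 < n) (x : G) :
    (walkAverage φ)^[n] (Pi.single 1 1) x ≤
      1 / (D ^ r).card + r * (Fintype.card T * √(2 / n)) := by
  have hn' : (0 : ℝ) < n := by exact_mod_cast hn
  set a : ℕ → G → ℝ := fun j => (walkAverage φ)^[j] (Pi.single 1 1) with ha
  have hsucc (j : ℕ) : a (j + 1) = walkAverage φ (a j) := Function.iterate_succ_apply' _ _ _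
  have hnonneg (j : ℕ) : ∀ x, 0 ≤ a j x := by
    induction j with
    | zero => intro x; simp only [ha, Function.iterate_zero, id, Pi.single_apply]; positivity
    | succ j ih => rw [hsucc]; exact walkAverage_nonneg φ ih
  have hmass (j : ℕ) : ∑ x, a j x = 1 := by
    induction j with
    | zero => simp [ha]
    | succ j ih => rw [hsucc, sum_walkAverage, ih]
  obtain ⟨j, hjn, hj⟩ : ∃ j < n, ∑ y, a j y ^ 2 - ∑ y, a (j + 1) y ^ 2 ≤ 1 / n := by
    by_contra! h
    have htel := sum_range_sub' (fun j => ∑ y, a j y ^ 2) n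
    have hlt : ∑ j ∈ range n, (1 / n : ℝ) < ∑ j ∈ range n, (∑ y, a j y ^ 2 - ∑ y, a (j + 1) y ^ 2) :=
      sum_lt_sum_of_nonempty ⟨0, mem_range.2 hn⟩ fun j hj => h j (mem_range.1 hj)
    rw [htel] at hlt
    have h0 : ∑ y, a 0 y ^ 2 = 1 := by simp [ha, Pi.single_apply]
    have h1 : 0 ≤ ∑ y, a n y ^ 2 := sum_nonneg fun _ _ => sq_nonneg _
    simp only [sum_const, card_range, nsmul_eq_mul, mul_one_div_cancel hn'.ne'] at hlt
    linarith
  have hδ : ∀ x s t, |a j (x * φ s) - a j (x * φ t)| ≤ Fintype.card T * √(2 / n) := by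
    intro x s t
    refine abs_le_of_sq_le_sq ?_ (by positivity)
    have h := sub_sq_le_sum_sq_sub_sum_walkAverage_sq φ (a j) x s t
    rw [← hsucc] at h
    rw [mul_pow, Real.sq_sqrt (by positivity)]
    calc _ ≤ _ := h
      _ ≤ 2 * Fintype.card T ^ 2 * (1 / n : ℝ) := by gcongr
      _ = _ := by ring
  have hbound (x : G) : a j x ≤ 1 / (D ^ r).card + r * (Fintype.card T * √(2 / n)) := by
    have hc : (0 : ℝ) < (D ^ r).card := by exact_mod_cast (hDne.pow).card_pos
    have h1 : ∑ g ∈ D ^ r, a j (x * g) ≤ 1 := by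
      rw [← hmass j, ← Equiv.sum_comp (Equiv.mulLeft x)]
      exact sum_le_sum_of_subset_of_nonneg (subset_univ _) fun _ _ _ => hnonneg _ _
    have h2 : (D ^ r).card • (a j x - r * (Fintype.card T * √(2 / n))) ≤
        ∑ g ∈ D ^ r, a j (x * g) := by
      refine card_nsmul_le_sum _ _ _ fun g hg => ?_
      linarith [le_abs_self (a j x - a j (x * g)), abs_sub_mul_pow_le hD hδ r g hg x]
    rw [nsmul_eq_mul, mul_comm] at h2
    linarith [(le_div_iff₀ hc).2 (h2.trans h1)]
  have hlater (i : ℕ) : ∀ x, a (j + i) x ≤ 1 / (D ^ r).card + r * (Fintype.card T * √(2 / n)) := by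
    induction i with
    | zero => exact hbound
    | succ i ih => rw [← add_assoc, hsucc]; exact walkAverage_le φ ih
  simpa only [Nat.add_sub_cancel' hjn.le] using hlater (n - j) x

end WalkAverage

section Reduction

variable {d : ℕ}

open scoped Pointwise in
theorem abs_entry_le_of_mem_pow [DecidableEq (GL (Fin d) ℤ)] {E : Finset (GL (Fin d) ℤ)} {A : ℤ}
    (hE : ∀ g ∈ E, ∀ i j, |g i j| ≤ A) (r : ℕ) :
    ∀ g ∈ E ^ r, ∀ i j, |g i j| ≤ (d * A) ^ r := by
  induction r with
  | zero =>
    intro g hg i j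
    rw [pow_zero, Finset.mem_one] at hg
    subst hg
    by_cases h : i = j <;> simp [h]
  | succ r ih =>
    intro g hg i j
    rw [pow_succ] at hg
    obtain ⟨h, hh, e, he, rfl⟩ := Finset.mem_mul.1 hg
    have hA : 0 ≤ (d * A) ^ r := (abs_nonneg _).trans (ih h hh i i)
    calc |(h * e) i j| = |∑ k, h i k * e k j| := by
          rw [Matrix.GeneralLinearGroup.coe_mul, Matrix.mul_apply]
      _ ≤ ∑ k, |h i k * e k j| := Finset.abs_sum_le_sum_abs _ _
      _ ≤ ∑ _k : Fin d, (d * A) ^ r * A := by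
          refine Finset.sum_le_sum fun k _ => ?_
          rw [abs_mul]
          exact mul_le_mul (ih h hh i k) (hE e he k j) (abs_nonneg _) hA
      _ = (d * A) ^ (r + 1) := by simp; ring

theorem injOn_map_castRingHom {q : ℕ} {X : Set (GL (Fin d) ℤ)} {M : ℤ}
    (hX : ∀ g ∈ X, ∀ i j, |g i j| ≤ M) (hM : 2 * M < q) :
    X.InjOn (Matrix.GeneralLinearGroup.map (Int.castRingHom (ZMod q))) := by
  intro g hg h hh heq
  ext i j
  have hij := congrArg (fun u : GL (Fin d) (ZMod q) => u i j) heq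
  simp only [Matrix.GeneralLinearGroup.map_apply, eq_intCast] at hij
  have hdvd : (q : ℤ) ∣ h i j - g i j := (ZMod.intCast_eq_intCast_iff_dvd_sub _ _ _).1 hij
  have hlt : |h i j - g i j| < q := by
    have := abs_sub (h i j) (g i j)
    linarith [hX g hg i j, hX h hh i j]
  linarith [Int.eq_zero_of_abs_lt_dvd hdvd hlt]

end Reduction

section Asymptotics

open Filter Asymptotics Topology

theorem eventually_div_four_le_theta : ∀ᶠ x : ℝ in atTop, x / 4 ≤ Chebyshev.theta x := by
  have h := (isLittleO_log_rpow_atTop (r := 1 / 2) (by norm_num)).bound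
    (show (0 : ℝ) < 1 / 16 by norm_num)
  filter_upwards [h, eventually_ge_atTop 10] with x hlog hx
  rw [← Real.sqrt_eq_rpow, Real.norm_of_nonneg (Real.log_nonneg (by linarith)),
    Real.norm_of_nonneg (Real.sqrt_nonneg x)] at hlog
  have hs : √x * √x = x := Real.mul_self_sqrt (by linarith)
  have hs1 : 1 ≤ √x := Real.one_le_sqrt.2 (by linarith)
  have hlog2 : Real.log (x + 2) ≤ Real.log 2 + Real.log x := by
    rw [← Real.log_mul (by norm_num) (by linarith)]
    exact Real.log_le_log (by linarith) (by linarith)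
  have hprod : √x * Real.log x ≤ x / 16 := by nlinarith
  have hsx : √x ≤ x := by nlinarith
  have := Chebyshev.theta_ge' (show 1 ≤ x by linarith)
  nlinarith [Real.log_two_gt_d9, Real.log_two_lt_d9]

theorem tendsto_logb_two_natCast_atTop :
    Tendsto (fun n : ℕ => Real.logb 2 n) atTop atTop :=
  (Real.tendsto_logb_atTop (by norm_num)).comp tendsto_natCast_atTop_atTop

theorem qfun_pos (n : ℕ) : 0 < qfun n :=
  Finset.prod_pos fun _ hp => (Finset.mem_filter.1 hp).2.pos

/-- The modulus `qfun n` outgrows `exp (c (log n)²)` for every `c`. -/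
theorem eventually_two_mul_pow_lt_qfun {K : ℝ} (hK : 1 ≤ K) :
    ∀ᶠ n : ℕ in atTop, 2 * K ^ ⌊Real.logb 2 n ^ 2⌋₊ < qfun n := by
  have hK0 : 0 < K := by linarith
  have htheta := (((tendsto_pow_atTop (α := ℝ) (n := 5) (by norm_num)).comp
    tendsto_logb_two_natCast_atTop)).eventually eventually_div_four_le_theta
  filter_upwards [htheta, tendsto_logb_two_natCast_atTop.eventually_ge_atTop
    (4 * (Real.log K + 1))] with n hn hL
  simp only [Function.comp_apply] at hn
  set L := Real.logb 2 n
  have hlogK : 0 ≤ Real.log K := Real.log_nonneg hK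
  have hq : Chebyshev.theta (L ^ 5) = Real.log (qfun n) := Chebyshev.theta_eq_log_primorial _
  rw [hq] at hn
  have hqpos : (0 : ℝ) < qfun n := by exact_mod_cast qfun_pos n
  rw [← Real.log_lt_log_iff (by positivity) hqpos,
    Real.log_mul (by norm_num) (by positivity), Real.log_pow]
  refine lt_of_lt_of_le ?_ hn
  have hfloor : (⌊L ^ 2⌋₊ : ℝ) ≤ L ^ 2 := Nat.floor_le (sq_nonneg _)
  have h1 : (⌊L ^ 2⌋₊ : ℝ) * Real.log K ≤ L ^ 2 * Real.log K := by gcongr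
  have hL1 : 1 ≤ L := by linarith
  have h2 : L ^ 3 ≤ L ^ 5 := pow_le_pow_right₀ hL1 (by norm_num)
  have h3 : L ^ 2 * (4 * (Real.log K + 1)) ≤ L ^ 2 * L := by gcongr
  have h4 : 1 ≤ L ^ 2 := one_le_pow₀ hL1
  linarith [Real.log_two_lt_d9, show L ^ 2 * L = L ^ 3 by ring]

theorem eventually_floor_mul_sqrt_le (k : ℝ) (hk : 0 < k) :
    ∀ᶠ n : ℕ in atTop,
      ⌊Real.logb 2 n ^ 2⌋₊ * (k * √(2 / n)) ≤ 1 / Real.logb 2 n ^ 2 := by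
  have h := tendsto_natCast_atTop_atTop.eventually
    ((Real.isLittleO_pow_logb_id_atTop (b := 2) (n := 8)).bound
      (show (0 : ℝ) < 1 / (2 * k ^ 2) by positivity))
  filter_upwards [h, eventually_gt_atTop 0,
    tendsto_logb_two_natCast_atTop.eventually_gt_atTop 0] with n hn hn0 hL
  set L := Real.logb 2 n
  have hn0' : (0 : ℝ) < n := by exact_mod_cast hn0
  rw [Real.norm_of_nonneg (by positivity), id, Real.norm_of_nonneg hn0'.le] at hn
  have hsqrt : √(2 / n) ≤ 1 / (k * L ^ 4) := by
    refine Real.sqrt_le_iff.2 ⟨by positivity, ?_⟩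
    rw [one_div, inv_pow, ← one_div, div_le_div_iff₀ hn0' (by positivity)]
    rw [one_div, ← div_eq_inv_mul, le_div_iff₀ (by positivity)] at hn
    linarith [show 2 * (k * L ^ 4) ^ 2 = L ^ 8 * (2 * k ^ 2) by ring]
  calc ⌊L ^ 2⌋₊ * (k * √(2 / n)) ≤ L ^ 2 * (k * (1 / (k * L ^ 4))) := by
        gcongr
        exact Nat.floor_le (sq_nonneg _)
    _ = _ := by field_simp

end Asymptotics

open scoped Pointwise in
/-- Bound, modulo `q`, for the number of words of length `n` with trivial product, in terms of the
size of the entries of short products. -/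
theorem card_words_map_eq_one_le {d : ℕ} {S : Finset (GL (Fin d) ℤ)} (hne : S.Nonempty)
    (hH : Infinite (Subgroup.closure (S : Set (GL (Fin d) ℤ)))) :
    ∃ K : ℤ, 1 ≤ K ∧ ∀ q n r : ℕ, 0 < q → 0 < n → 2 * K ^ r < q →
      (Nat.card {w : Fin n → {A : GL (Fin d) ℤ // A ∈ S ∨ A⁻¹ ∈ S} //
          ((List.ofFn fun i => ((w i : GL (Fin d) ℤ) : Matrix (Fin d) (Fin d) ℤ)).prod).map
            (Int.cast : ℤ → ZMod q) = 1} : ℝ) ≤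
        (Nat.card {A : GL (Fin d) ℤ // A ∈ S ∨ A⁻¹ ∈ S} : ℝ) ^ n *
          (1 / (r + 1) +
            r * ((Nat.card {A : GL (Fin d) ℤ // A ∈ S ∨ A⁻¹ ∈ S} : ℝ) * √(2 / n))) := by
  classical
  set T : Finset (GL (Fin d) ℤ) := S ∪ S⁻¹ with hT
  have memT (g : GL (Fin d) ℤ) : g ∈ T ↔ g ∈ S ∨ g⁻¹ ∈ S := by
    simp [hT, Finset.mem_inv']
  have hTinv : ∀ t ∈ T, t⁻¹ ∈ T := fun t ht => by
    rw [memT, inv_inv, or_comm]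
    exact (memT t).1 ht
  have hTne : T.Nonempty := hne.mono Finset.subset_union_left
  have hTinf : (Subgroup.closure (T : Set (GL (Fin d) ℤ)) : Set (GL (Fin d) ℤ)).Infinite :=
    (Set.infinite_coe_iff.1 hH).mono (Subgroup.closure_mono (Finset.subset_union_left))
  obtain ⟨A, hA⟩ : ∃ A : ℤ, ∀ g ∈ T * T, ∀ i j, |g i j| ≤ A := by
    refine ⟨∑ g ∈ T * T, ∑ i, ∑ j, |g i j|, fun g hg i j => ?_⟩
    calc |g i j| ≤ ∑ j, |g i j| :=
          Finset.single_le_sum (f := fun j => |g i j|) (fun _ _ => abs_nonneg _)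
            (Finset.mem_univ j)
      _ ≤ ∑ i, ∑ j, |g i j| :=
          Finset.single_le_sum (f := fun i => ∑ j, |g i j|) (fun _ _ => by positivity)
            (Finset.mem_univ i)
      _ ≤ _ := Finset.single_le_sum (f := fun g : GL (Fin d) ℤ => ∑ i, ∑ j, |g i j|)
            (fun _ _ => by positivity) hg
  set A' : ℤ := max A 1
  have hA' : ∀ g ∈ T * T, ∀ i j, |g i j| ≤ A' :=
    fun g hg i j => (hA g hg i j).trans (le_max_left _ _)
  have hA'1 : 1 ≤ A' := le_max_right _ _
  refine ⟨max (d * A') 1, le_max_right _ _, fun q n r hq hn hqr => ?_⟩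
  have : NeZero q := ⟨hq.ne'⟩
  let _ : Fintype {A : GL (Fin d) ℤ // A ∈ S ∨ A⁻¹ ∈ S} := Fintype.subtype T memT
  have : Nonempty {A : GL (Fin d) ℤ // A ∈ S ∨ A⁻¹ ∈ S} :=
    let ⟨t, ht⟩ := hTne; ⟨⟨t, (memT t).1 ht⟩⟩
  let _ : Fintype (GL (Fin d) (ZMod q)) := Fintype.ofFinite _
  set ψ := Matrix.GeneralLinearGroup.map (n := Fin d) (Int.castRingHom (ZMod q)) with hψ
  let φ : {A : GL (Fin d) ℤ // A ∈ S ∨ A⁻¹ ∈ S} → GL (Fin d) (ZMod q) := fun t => ψ t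
  have hD : ∀ g ∈ (T * T).image ψ, ∃ s t, g = (φ s)⁻¹ * φ t := by
    intro g hg
    obtain ⟨_, hst, rfl⟩ := Finset.mem_image.1 hg
    obtain ⟨s, hs, t, ht, rfl⟩ := Finset.mem_mul.1 hst
    exact ⟨⟨s⁻¹, (memT _).1 (hTinv s hs)⟩, ⟨t, (memT t).1 ht⟩, by simp [φ]⟩
  have hcard : r + 1 ≤ (((T * T).image ψ) ^ r).card := by
    rw [← Finset.image_pow, Finset.card_image_of_injOn]
    · exact succ_le_card_mul_self_pow T hTinv hTne hTinf r
    · refine injOn_map_castRingHom (M := max (d * A') 1 ^ r) (fun g hg i j => ?_) hqr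
      refine (abs_entry_le_of_mem_pow hA' r g hg i j).trans ?_
      gcongr
      exact le_max_left _ _
  have hwords (w : Fin n → {A : GL (Fin d) ℤ // A ∈ S ∨ A⁻¹ ∈ S}) :
      ((List.ofFn fun i => ((w i : GL (Fin d) ℤ) : Matrix (Fin d) (Fin d) ℤ)).prod).map
        (Int.cast : ℤ → ZMod q) = 1 ↔ (List.ofFn fun i => φ (w i)).prod = 1⁻¹ := by
    have h1 : (List.ofFn fun i => φ (w i)).prod = ψ (List.ofFn fun i => (w i).1).prod := by
      rw [map_list_prod, List.map_ofFn]
      rfl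
    have h2 : (List.ofFn fun i => ((w i : GL (Fin d) ℤ) : Matrix (Fin d) (Fin d) ℤ)).prod =
        ((List.ofFn fun i => (w i).1).prod : GL (Fin d) ℤ).val := by
      rw [← Units.coeHom_apply, map_list_prod, List.map_ofFn]
      rfl
    rw [h1, h2, inv_one, Units.ext_iff]
    rfl
  rw [Nat.card_congr (Equiv.subtypeEquivRight hwords), card_words_prod_eq,
    Nat.card_eq_fintype_card]
  have hwalk := walkAverage_iterate_le φ hD ((hTne.mul hTne).image ψ) n r hn 1
  gcongr
  refine hwalk.trans ?_
  gcongr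
  exact_mod_cast hcard

/-- If `Σ` is a finite nonempty set of matrices in `GL_d(ℤ)` containing no matrix together with
its inverse, and the subgroup it generates is infinite, then there is `C > 0` such that for all
`n ≥ 2`, the number of words of length `n` over `Σ̃ = Σ ∪ Σ⁻¹` whose product is the identity
modulo `q n` is at most `C · |Σ̃|ⁿ / (log₂ n)²`. -/
theorem wp_identity_mod_q_rare (d : ℕ) (hd : 1 ≤ d) (S : Finset (GL (Fin d) ℤ))
    (hne : S.Nonempty) (hinv : ∀ A ∈ S, A⁻¹ ∉ S)
    (hH : Infinite (Subgroup.closure (S : Set (GL (Fin d) ℤ)))) :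
    ∃ C : ℝ, 0 < C ∧ ∀ n : ℕ, 2 ≤ n →
      (Nat.card {w : Fin n → {A : GL (Fin d) ℤ // A ∈ S ∨ A⁻¹ ∈ S} //
          ((List.ofFn fun i => ((w i : GL (Fin d) ℤ) : Matrix (Fin d) (Fin d) ℤ)).prod).map
            (Int.cast : ℤ → ZMod (qfun n)) = 1} : ℝ)
        ≤ C * (Nat.card {A : GL (Fin d) ℤ // A ∈ S ∨ A⁻¹ ∈ S} : ℝ) ^ n
            / (Real.logb 2 n) ^ 2 := by
  obtain ⟨K, hK, hbound⟩ := card_words_map_eq_one_le hne hH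
  set k : ℝ := (Nat.card {A : GL (Fin d) ℤ // A ∈ S ∨ A⁻¹ ∈ S} : ℝ) with hk
  have hfin : Finite {A : GL (Fin d) ℤ // A ∈ S ∨ A⁻¹ ∈ S} :=
    (S.finite_toSet.union (S.finite_toSet.preimage inv_injective.injOn)).to_subtype
  have hkpos : 0 < k := by
    obtain ⟨s, hs⟩ := hne
    have : Nonempty {A : GL (Fin d) ℤ // A ∈ S ∨ A⁻¹ ∈ S} := ⟨⟨s, Or.inl hs⟩⟩
    exact Nat.cast_pos.2 Nat.card_pos
  obtain ⟨N, hN⟩ := Filter.eventually_atTop.1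
    ((eventually_two_mul_pow_lt_qfun (K := K) (by exact_mod_cast hK)).and
      (eventually_floor_mul_sqrt_le k hkpos))
  refine ⟨2 + Real.logb 2 N ^ 2, by positivity, fun n hn => ?_⟩
  have hL : 1 ≤ Real.logb 2 n := by
    rw [Real.le_logb_iff_rpow_le (by norm_num) (by positivity)]
    simpa using (by exact_mod_cast hn : (2 : ℝ) ≤ n)
  have hL2 : 0 < Real.logb 2 n ^ 2 := by positivity
  rcases lt_or_ge n N with hnN | hnN
  · have htriv : (Nat.card {w : Fin n → {A : GL (Fin d) ℤ // A ∈ S ∨ A⁻¹ ∈ S} //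
        ((List.ofFn fun i => ((w i : GL (Fin d) ℤ) : Matrix (Fin d) (Fin d) ℤ)).prod).map
          (Int.cast : ℤ → ZMod (qfun n)) = 1} : ℝ) ≤ k ^ n := by
      have h := Finite.card_subtype_le
        (fun w : Fin n → {A : GL (Fin d) ℤ // A ∈ S ∨ A⁻¹ ∈ S} =>
          ((List.ofFn fun i => ((w i : GL (Fin d) ℤ) : Matrix (Fin d) (Fin d) ℤ)).prod).map
            (Int.cast : ℤ → ZMod (qfun n)) = 1)
      rw [Nat.card_fun, Nat.card_fin] at h
      rw [hk, ← Nat.cast_pow]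
      exact Nat.cast_le.2 h
    refine htriv.trans ?_
    rw [le_div_iff₀ hL2, mul_comm]
    gcongr
    have : Real.logb 2 n ≤ Real.logb 2 N :=
      Real.logb_le_logb_of_le (by norm_num) (by positivity) (by exact_mod_cast hnN.le)
    nlinarith
  · obtain ⟨hq, hsmall⟩ := hN n hnN
    refine (hbound (qfun n) n ⌊Real.logb 2 n ^ 2⌋₊ (qfun_pos n) (by lia)
      (by exact_mod_cast hq)).trans ?_
    have hfloor : 1 / ((⌊Real.logb 2 n ^ 2⌋₊ : ℝ) + 1) ≤ 1 / Real.logb 2 n ^ 2 :=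
      one_div_le_one_div_of_le hL2 (Nat.lt_floor_add_one _).le
    rw [mul_comm _ (k ^ n), mul_div_assoc]
    gcongr
    calc _ ≤ 1 / Real.logb 2 n ^ 2 + 1 / Real.logb 2 n ^ 2 := add_le_add hfloor hsmall
      _ = 2 / Real.logb 2 n ^ 2 := by ring
      _ ≤ _ := by
        gcongr
        linarith [sq_nonneg (Real.logb 2 N)]
end

section
/- Let d ≥ 1 and let A ∈ GL_d(ℤ) be a matrix of infinite order. Then there exists a constant C > 0 (depending on A and d) such that for every integer 𝔬 ≥ 1, the set of primes p for which the reduction of A modulo p has order at most 𝔬 in GL_d(ℤ/pℤ) is finite of cardinality at most C · 𝔬². -/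
open Matrix

theorem Nat.two_pow_card_primeFactors_le {m : ℕ} (hm : m ≠ 0) :
    2 ^ m.primeFactors.card ≤ m :=
  calc 2 ^ m.primeFactors.card ≤ ∏ p ∈ m.primeFactors, p :=
        Finset.pow_card_le_prod _ _ _ fun _ hp => (Nat.prime_of_mem_primeFactors hp).two_le
    _ ≤ m := Nat.le_of_dvd (Nat.pos_of_ne_zero hm) (Nat.prod_primeFactors_dvd m)

theorem Matrix.exists_natAbs_pow_sub_one_apply_le {ι : Type*} [Fintype ι] [DecidableEq ι]
    (A : Matrix ι ι ℤ) :
    ∃ K : ℕ, ∀ n : ℕ, 1 ≤ n → ∀ i j, ((A ^ n - 1) i j).natAbs ≤ 2 ^ (K * n) := by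
  set M : ℕ := 1 + ∑ j, ∑ i, (A i j).natAbs with hM
  have hpow : ∀ n i j, ((A ^ n) i j).natAbs ≤ M ^ n := by
    intro n
    induction n with
    | zero =>
      intro i j
      rw [pow_zero, Matrix.one_apply]
      split_ifs <;> simp
    | succ n ih =>
      intro i j
      rw [pow_succ, Matrix.mul_apply]
      calc (∑ k, (A ^ n) i k * A k j).natAbs
          ≤ ∑ k, ((A ^ n) i k * A k j).natAbs := Int.natAbs_sum_le _ _
        _ ≤ ∑ k, M ^ n * (A k j).natAbs := by
            refine Finset.sum_le_sum fun k _ => ?_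
            rw [Int.natAbs_mul]
            exact Nat.mul_le_mul_right _ (ih i k)
        _ = M ^ n * ∑ k, (A k j).natAbs := (Finset.mul_sum _ _ _).symm
        _ ≤ M ^ n * M := by
            refine Nat.mul_le_mul_left _ ?_
            have : ∑ k, (A k j).natAbs ≤ ∑ j, ∑ k, (A k j).natAbs :=
              Finset.single_le_sum (f := fun j => ∑ i, (A i j).natAbs)
                (fun _ _ => Nat.zero_le _) (Finset.mem_univ j)
            omega
        _ = M ^ (n + 1) := (pow_succ _ _).symm
  refine ⟨M + 1, fun n hn i j => ?_⟩
  have hone : ((1 : Matrix ι ι ℤ) i j).natAbs ≤ 1 := by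
    rw [Matrix.one_apply]
    split_ifs <;> simp
  calc ((A ^ n - 1) i j).natAbs
      ≤ ((A ^ n) i j).natAbs + ((1 : Matrix ι ι ℤ) i j).natAbs := Int.natAbs_sub_le _ _
    _ ≤ M ^ n + 1 ^ n := by
        rw [one_pow]
        exact Nat.add_le_add (hpow n i j) hone
    _ ≤ (M + 1) ^ n := pow_add_pow_le (Nat.zero_le _) (Nat.zero_le _) (by omega)
    _ ≤ (2 ^ (M + 1)) ^ n := Nat.pow_le_pow_left Nat.lt_two_pow_self.le n
    _ = 2 ^ ((M + 1) * n) := (pow_mul _ _ _).symm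

theorem Matrix.GeneralLinearGroup.dvd_pow_sub_one_apply_of_map_pow_eq_one {ι : Type*}
    [Fintype ι] [DecidableEq ι] {A : GL ι ℤ} {p n : ℕ}
    (h : Matrix.GeneralLinearGroup.map (Int.castRingHom (ZMod p)) A ^ n = 1) (i j : ι) :
    p ∣ (((A : Matrix ι ι ℤ) ^ n - 1) i j).natAbs := by
  rw [← Int.natCast_dvd, ← ZMod.intCast_zmod_eq_zero_iff_dvd]
  rw [← map_pow] at h
  have h' := congrArg (fun B : GL ι (ZMod p) => (B : Matrix ι ι (ZMod p)) i j) h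
  simp only [Matrix.GeneralLinearGroup.map_apply, Units.val_pow_eq_pow_val, Units.val_one,
    eq_intCast] at h'
  rw [Matrix.sub_apply, Int.cast_sub, h', Matrix.one_apply, Matrix.one_apply]
  split_ifs <;> simp

/-- If `A ∈ GL_d(ℤ)` has infinite order, then there is a constant `C > 0` such that for every
`𝔬 ≥ 1`, the set of primes `p` for which the reduction of `A` mod `p` has order at most `𝔬`
in `GL_d(ℤ/pℤ)` is finite, of cardinality at most `C · 𝔬²`. -/
theorem primes_with_small_order_of_reduction (d : ℕ) (hd : 1 ≤ d) (A : GL (Fin d) ℤ)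
    (hA : ∀ n : ℕ, 1 ≤ n → A ^ n ≠ 1) :
    ∃ C : ℝ, 0 < C ∧ ∀ o : ℕ, 1 ≤ o →
      {p : ℕ | p.Prime ∧
          orderOf (Matrix.GeneralLinearGroup.map (Int.castRingHom (ZMod p)) A) ≤ o}.Finite ∧
      ({p : ℕ | p.Prime ∧
          orderOf (Matrix.GeneralLinearGroup.map (Int.castRingHom (ZMod p)) A) ≤ o}.ncard : ℝ)
        ≤ C * (o : ℝ) ^ 2 := by
  obtain ⟨K, hK⟩ := Matrix.exists_natAbs_pow_sub_one_apply_le (A : Matrix (Fin d) (Fin d) ℤ)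
  have hentry : ∀ n : ℕ, ∃ i j, 1 ≤ n →
      ((A : Matrix (Fin d) (Fin d) ℤ) ^ n - 1) i j ≠ 0 := by
    intro n
    by_contra! h
    have hn : 1 ≤ n := (h ⟨0, hd⟩ ⟨0, hd⟩).1
    refine hA n hn (Units.ext ?_)
    rw [Units.val_pow_eq_pow_val, Units.val_one, ← sub_eq_zero]
    ext i j
    exact (h i j).2
  choose r c hrc using hentry
  set e : ℕ → ℕ := fun n => (((A : Matrix (Fin d) (Fin d) ℤ) ^ n - 1) (r n) (c n)).natAbs
  have he : ∀ n, 1 ≤ n → e n ≠ 0 := fun n hn => Int.natAbs_ne_zero.mpr (hrc n hn)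
  refine ⟨K + 1, by positivity, fun o _ => ?_⟩
  set S : Finset ℕ := (Finset.Icc 1 o).biUnion fun n => (e n).primeFactors
  have hsub : {p : ℕ | p.Prime ∧
      orderOf (Matrix.GeneralLinearGroup.map (Int.castRingHom (ZMod p)) A) ≤ o} ⊆ (S : Set ℕ) := by
    rintro p ⟨hp, hpo⟩
    have : Fact p.Prime := ⟨hp⟩
    have hpos := orderOf_pos (Matrix.GeneralLinearGroup.map (Int.castRingHom (ZMod p)) A)
    refine Finset.mem_biUnion.mpr ⟨_, Finset.mem_Icc.mpr ⟨hpos, hpo⟩, ?_⟩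
    exact Nat.mem_primeFactors.mpr ⟨hp,
      Matrix.GeneralLinearGroup.dvd_pow_sub_one_apply_of_map_pow_eq_one (pow_orderOf_eq_one _) _ _,
      he _ hpos⟩
  have hcard : S.card ≤ o * (K * o) := by
    have := Finset.card_biUnion_le_card_mul (Finset.Icc 1 o) (fun n => (e n).primeFactors) (K * o)
      fun n hn => by
        obtain ⟨h1, h2⟩ := Finset.mem_Icc.mp hn
        have h3 := (Nat.two_pow_card_primeFactors_le (he n h1)).trans (hK n h1 _ _)
        exact ((Nat.pow_le_pow_iff_right one_lt_two).mp h3).trans (Nat.mul_le_mul_left K h2)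
    simpa using this
  refine ⟨S.finite_toSet.subset hsub, ?_⟩
  have hn := (Set.ncard_le_ncard hsub S.finite_toSet).trans_eq (Set.ncard_coe_finset S)
  have hle : (Set.ncard {p : ℕ | p.Prime ∧
      orderOf (Matrix.GeneralLinearGroup.map (Int.castRingHom (ZMod p)) A) ≤ o} : ℝ)
      ≤ o * (K * o) := by
    exact_mod_cast hn.trans hcard
  nlinarith [sq_nonneg (o : ℝ)]
end

section
/- Let d ≥ 1, let A ∈ GL_d(ℤ) be a matrix of infinite order, and let q(n) be defined by q(0) = q(1) = 1 and q(n) = ∏_{p prime, p ≤ (log n)⁵} p for n ≥ 2 (logarithms in base 2). Then for every sufficiently large n, there exists a prime p dividing q(n) (equivalently, a prime p ≤ (log n)⁵) such that the reduction of A modulo p has order at least 2 (log n)² in GL_d(ℤ/pℤ). -/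
/-- The entries of the powers of an integer matrix grow at most exponentially. -/
theorem Matrix.exists_natAbs_pow_apply_le {ι : Type*} [Fintype ι] [DecidableEq ι]
    (M : Matrix ι ι ℤ) :
    ∃ C : ℕ, ∀ k i j, ((M ^ k) i j).natAbs ≤ C ^ k := by
  refine ⟨∑ l, ∑ j, (M l j).natAbs, fun k ↦ ?_⟩
  induction k with
  | zero =>
    intro i j
    rw [pow_zero, Matrix.one_apply]
    split_ifs <;> simp
  | succ k ih =>
    intro i j
    rw [pow_succ, Matrix.mul_apply, pow_succ, Finset.mul_sum]
    refine (Int.natAbs_sum_le _ _).trans (Finset.sum_le_sum fun l _ ↦ ?_)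
    rw [Int.natAbs_mul]
    exact Nat.mul_le_mul (ih i l)
      (Finset.single_le_sum (f := fun j ↦ (M l j).natAbs) (fun _ _ ↦ Nat.zero_le _)
        (Finset.mem_univ j))

/-- If `A` has infinite order, then there is a nonzero integer of size at most exponential in `k`
that is divisible by every modulus over which `A ^ k` reduces to the identity. -/
theorem Matrix.GeneralLinearGroup.exists_dvd_of_map_pow_eq_one {ι : Type*} [Fintype ι]
    [DecidableEq ι] (A : GL ι ℤ) (hA : ∀ n : ℕ, 1 ≤ n → A ^ n ≠ 1) :
    ∃ C : ℕ, 1 ≤ C ∧ ∀ k : ℕ, 1 ≤ k → ∃ e : ℕ, e ≠ 0 ∧ e ≤ C ^ k ∧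
      ∀ m : ℕ, Matrix.GeneralLinearGroup.map (Int.castRingHom (ZMod m)) A ^ k = 1 → m ∣ e := by
  obtain ⟨C, hC⟩ := Matrix.exists_natAbs_pow_apply_le (A : Matrix ι ι ℤ)
  refine ⟨C + 1, Nat.le_add_left 1 C, fun k hk ↦ ?_⟩
  obtain ⟨i, j, hij⟩ : ∃ i j, ((A : Matrix ι ι ℤ) ^ k) i j ≠ (1 : Matrix ι ι ℤ) i j := by
    by_contra! h
    exact hA k hk (Units.ext (Matrix.ext fun i j ↦ by simpa using h i j))
  refine ⟨(((A : Matrix ι ι ℤ) ^ k) i j - (1 : Matrix ι ι ℤ) i j).natAbs,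
    Int.natAbs_ne_zero.2 (sub_ne_zero.2 hij), ?_, fun m hm ↦ ?_⟩
  · have h_one : ((1 : Matrix ι ι ℤ) i j).natAbs ≤ 1 := by
      rw [Matrix.one_apply]
      split_ifs <;> simp
    calc (((A : Matrix ι ι ℤ) ^ k) i j - (1 : Matrix ι ι ℤ) i j).natAbs
        ≤ C ^ k + 1 := (Int.natAbs_sub_le _ _).trans (add_le_add (hC k i j) h_one)
      _ = C ^ k + 1 ^ k := by rw [one_pow]
      _ ≤ (C + 1) ^ k := pow_add_pow_le (Nat.zero_le _) zero_le_one (by omega)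
  · rw [← Int.natCast_dvd, ← ZMod.intCast_zmod_eq_zero_iff_dvd]
    rw [← map_pow] at hm
    have h := congrArg (fun B : GL ι (ZMod m) ↦ (B : Matrix ι ι (ZMod m)) i j) hm
    simp only [Matrix.GeneralLinearGroup.map_apply, Units.val_pow_eq_pow_val, Units.val_one,
      eq_intCast] at h
    rw [Int.cast_sub, h, Matrix.one_apply, Matrix.one_apply]
    split_ifs <;> simp

/-- If `A` has infinite order but its reductions modulo all primes up to `x` have order at most
`K`, then `x` is at most of order `K ^ 2` (measured by `Chebyshev.theta`). -/
theorem Matrix.GeneralLinearGroup.exists_theta_le_of_orderOf_map_le {ι : Type*} [Fintype ι]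
    [DecidableEq ι] (A : GL ι ℤ) (hA : ∀ n : ℕ, 1 ≤ n → A ^ n ≠ 1) :
    ∃ c : ℝ, ∀ (x : ℝ) (K : ℕ),
      (∀ p : ℕ, p.Prime → p ≤ ⌊x⌋₊ →
        orderOf (Matrix.GeneralLinearGroup.map (Int.castRingHom (ZMod p)) A) ≤ K) →
      Chebyshev.theta x ≤ c * (K : ℝ) ^ 2 := by
  obtain ⟨C, hC, h⟩ := Matrix.GeneralLinearGroup.exists_dvd_of_map_pow_eq_one A hA
  choose! e he0 heC he using h
  refine ⟨Real.log C, fun x K hK ↦ ?_⟩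
  have h_dvd : primorial ⌊x⌋₊ ∣ ∏ k ∈ Finset.Icc 1 K, e k := by
    refine Finset.prod_primes_dvd _ (fun p hp ↦ (Finset.mem_filter.1 hp).2.prime) fun p hp ↦ ?_
    obtain ⟨hpx, hp⟩ := Finset.mem_filter.1 hp
    have := Fact.mk hp
    have h_pos := orderOf_pos (Matrix.GeneralLinearGroup.map (Int.castRingHom (ZMod p)) A)
    exact (he _ h_pos p (pow_orderOf_eq_one _)).trans (Finset.dvd_prod_of_mem e
      (Finset.mem_Icc.2 ⟨h_pos, hK p hp (Nat.lt_succ_iff.1 (Finset.mem_range.1 hpx))⟩))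
  have h_le : primorial ⌊x⌋₊ ≤ C ^ (K ^ 2) :=
    calc primorial ⌊x⌋₊ ≤ ∏ k ∈ Finset.Icc 1 K, e k :=
          Nat.le_of_dvd (Finset.prod_pos fun k hk ↦
            Nat.pos_of_ne_zero (he0 k (Finset.mem_Icc.1 hk).1)) h_dvd
      _ ≤ ∏ _k ∈ Finset.Icc 1 K, C ^ K := Finset.prod_le_prod' fun k hk ↦
          (heC k (Finset.mem_Icc.1 hk).1).trans
            (Nat.pow_le_pow_right hC (Finset.mem_Icc.1 hk).2)
      _ = C ^ (K ^ 2) := by rw [Finset.prod_const, Nat.card_Icc, Nat.add_sub_cancel, ← pow_mul, sq]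
  rw [Chebyshev.theta_eq_log_primorial]
  calc Real.log (primorial ⌊x⌋₊) ≤ Real.log ((C : ℝ) ^ (K ^ 2)) :=
        Real.log_le_log (mod_cast primorial_pos _) (mod_cast h_le)
    _ = Real.log C * (K : ℝ) ^ 2 := by rw [Real.log_pow]; push_cast; ring

/-- A form of the Chebyshev lower bound for `θ`. -/
theorem Chebyshev.eventually_half_mul_le_theta :
    ∀ᶠ x : ℝ in Filter.atTop, x / 2 ≤ Chebyshev.theta x := by
  have h_log := (isLittleO_log_rpow_atTop (r := 1 / 2) (by norm_num)).bound
    (show (0 : ℝ) < 1 / 100 by norm_num)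
  filter_upwards [h_log, Filter.eventually_ge_atTop 10] with x hx hx10
  have h_log_nonneg : 0 ≤ Real.log x := Real.log_nonneg (by linarith)
  rw [← Real.sqrt_eq_rpow, Real.norm_of_nonneg h_log_nonneg,
    Real.norm_of_nonneg (Real.sqrt_nonneg x)] at hx
  have h_sq : √x * √x = x := Real.mul_self_sqrt (by linarith)
  have h_sqrt : 1 ≤ √x := Real.one_le_sqrt.2 (by linarith)
  have h_log_add : Real.log (x + 2) ≤ 2 * Real.log x := by
    rw [← Nat.cast_ofNat, ← Real.log_pow]
    exact Real.log_le_log (by positivity) (by push_cast; nlinarith)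
  have h_theta := Chebyshev.theta_ge' (x := x) (by linarith)
  have h_two : 0.69 ≤ Real.log 2 := by linarith [Real.log_two_gt_d9]
  nlinarith [mul_le_mul_of_nonneg_left hx (Real.sqrt_nonneg x),
    mul_le_mul_of_nonneg_left h_two (show 0 ≤ x - 1 by linarith)]


open Matrix

/-- If `A ∈ GL_d(ℤ)` has infinite order, then for every sufficiently large `n` there is a
prime `p` dividing `q n` such that the reduction of `A` modulo `p` has order at least
`2 (log₂ n)²` in `GL_d(ℤ/pℤ)`. -/
theorem exists_prime_divisor_with_large_order (d : ℕ) (hd : 1 ≤ d) (A : GL (Fin d) ℤ)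
    (hA : ∀ n : ℕ, 1 ≤ n → A ^ n ≠ 1) :
    ∃ N : ℕ, ∀ n : ℕ, N ≤ n → ∃ p : ℕ, p.Prime ∧ p ∣ qfun n ∧
      2 * (Real.logb 2 n) ^ 2
        ≤ (orderOf (Matrix.GeneralLinearGroup.map (Int.castRingHom (ZMod p)) A) : ℝ) := by
  obtain ⟨c, hc⟩ := Matrix.GeneralLinearGroup.exists_theta_le_of_orderOf_map_le A hA
  have h_logb : Filter.Tendsto (fun n : ℕ ↦ Real.logb 2 n) Filter.atTop Filter.atTop :=
    (Real.tendsto_logb_atTop (by norm_num)).comp tendsto_natCast_atTop_atTop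
  have h_theta := ((Filter.tendsto_pow_atTop (by norm_num : 5 ≠ 0)).comp h_logb).eventually
    Chebyshev.eventually_half_mul_le_theta
  obtain ⟨N, hN⟩ := Filter.eventually_atTop.1
    (h_theta.and (h_logb.eventually (Filter.eventually_gt_atTop (max 0 (8 * c)))))
  refine ⟨N, fun n hn ↦ ?_⟩
  obtain ⟨h_lower, h_large⟩ := hN n hn
  rw [Function.comp_apply] at h_lower
  obtain ⟨h_pos, h_large⟩ := max_lt_iff.1 h_large
  by_contra! h
  have h_upper := hc (Real.logb 2 n ^ 5) ⌊2 * Real.logb 2 n ^ 2⌋₊ fun p hp hpx ↦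
    Nat.le_floor (h p hp (Finset.dvd_prod_of_mem _
      (Finset.mem_filter.2 ⟨Finset.mem_range.2 (Nat.lt_succ_iff.2 hpx), hp⟩))).le
  set L := Real.logb 2 n
  have h_floor : (⌊2 * L ^ 2⌋₊ : ℝ) ^ 2 ≤ (2 * L ^ 2) ^ 2 :=
    pow_le_pow_left₀ (Nat.cast_nonneg _) (Nat.floor_le (by positivity)) 2
  have h_gap : 8 * c * L ^ 4 < L * L ^ 4 := mul_lt_mul_of_pos_right h_large (by positivity)
  rcases le_total 0 c with h_c | h_c
  · nlinarith [mul_le_mul_of_nonneg_left h_floor h_c]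
  · nlinarith [mul_nonneg_of_nonpos_of_nonpos h_c (neg_nonpos.2 (sq_nonneg (⌊2 * L ^ 2⌋₊ : ℝ))),
      pow_pos h_pos 5]
end

section
/- Let d ≥ 1 and let T be a finite set of upper-triangular matrices in GL_d(ℤ). Then there exists a constant C > 0 (depending on d and T) such that for every n ≥ 1, every sequence A₁, …, A_n of matrices from T, and all indices 1 ≤ i ≤ j ≤ d, the (i,j)-entry of the product A₁⋯A_n satisfies |(A₁⋯A_n)_{i,j}| ≤ C · n^{j−i}; moreover (A₁⋯A_n)_{i,j} = 0 whenever i > j. In particular, each entry of a product of n matrices from T is bounded by a polynomial in n of degree j − i. -/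
/-- The diagonal entries of an invertible upper-triangular integer matrix are `±1`. -/
theorem Matrix.abs_diag_eq_one_of_isUnit_of_upperTriangular {d : ℕ}
    {A : Matrix (Fin d) (Fin d) ℤ} (hut : ∀ i j : Fin d, j < i → A i j = 0) (hA : IsUnit A)
    (i : Fin d) : |A i i| = 1 := by
  have hdet : A.det = ∏ k, A k k := Matrix.det_of_isUpperTriangular fun a b h => hut a b h
  have hunit : IsUnit (∏ k, A k k) := hdet ▸ (Matrix.isUnit_iff_isUnit_det A).mp hA
  exact Int.isUnit_iff_abs_eq.mp
    (isUnit_of_dvd_unit (Finset.dvd_prod_of_mem (fun k => A k k) (Finset.mem_univ i)) hunit)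

/-- A product of upper-triangular matrices is upper triangular. -/
theorem Matrix.mul_apply_eq_zero_of_upperTriangular {d : ℕ} {A B : Matrix (Fin d) (Fin d) ℤ}
    (hA : ∀ i j : Fin d, j < i → A i j = 0) (hB : ∀ i j : Fin d, j < i → B i j = 0)
    {i j : Fin d} (hij : j < i) : (A * B) i j = 0 := by
  rw [Matrix.mul_apply]
  refine Finset.sum_eq_zero fun k _ => ?_
  rcases lt_or_ge k i with h | h
  · rw [hA i k h, zero_mul]
  · rw [hB k j (hij.trans_le h), mul_zero]

/-- If `A` is upper triangular with diagonal `±1` and entries bounded by `M`, and `B` is upper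
triangular with `|B i j| ≤ x ^ (j - i)` for some `x ≥ 1`, then
`|(A * B) i j| ≤ (x + d * M) ^ (j - i)`. -/
theorem Matrix.abs_mul_apply_le_pow_of_upperTriangular {d : ℕ} {A B : Matrix (Fin d) (Fin d) ℤ}
    {M x : ℤ} (hM : 0 ≤ M) (hx : 1 ≤ x) (hA : ∀ i j : Fin d, j < i → A i j = 0)
    (hdiag : ∀ i, |A i i| = 1) (hAM : ∀ i j, |A i j| ≤ M)
    (hB : ∀ i j : Fin d, j < i → B i j = 0)
    (hBx : ∀ i j : Fin d, i ≤ j → |B i j| ≤ x ^ ((j : ℕ) - (i : ℕ)))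
    {i j : Fin d} (hij : i ≤ j) :
    |(A * B) i j| ≤ (x + d * M) ^ ((j : ℕ) - (i : ℕ)) := by
  have hx0 : 0 ≤ x := by lia
  have hterm : ∀ k : Fin d, |A i k * B k j| ≤ (if k = i then x ^ ((j : ℕ) - (i : ℕ)) else 0) +
      (if i < j then M * x ^ ((j : ℕ) - (i : ℕ) - 1) else 0) := by
    intro k
    have h₁ : 0 ≤ (if k = i then x ^ ((j : ℕ) - (i : ℕ)) else 0) := by positivity
    have h₂ : 0 ≤ (if i < j then M * x ^ ((j : ℕ) - (i : ℕ) - 1) else 0) := by positivity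
    rw [abs_mul]
    rcases lt_trichotomy k i with hk | rfl | hk
    · rw [hA i k hk, abs_zero, zero_mul]
      exact add_nonneg h₁ h₂
    · rw [hdiag, one_mul, if_pos rfl]
      exact (hBx k j hij).trans (le_add_of_nonneg_right h₂)
    · rcases lt_or_ge j k with hkj | hkj
      · rw [hB k j hkj, abs_zero, mul_zero]
        exact add_nonneg h₁ h₂
      · rw [if_pos (hk.trans_le hkj)]
        refine le_add_of_nonneg_of_le h₁ ?_
        have hexp : (j : ℕ) - (k : ℕ) ≤ (j : ℕ) - (i : ℕ) - 1 := by
          have := Fin.lt_def.mp hk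
          omega
        exact mul_le_mul (hAM i k) ((hBx k j hkj).trans (pow_le_pow_right₀ hx hexp))
          (abs_nonneg _) hM
  rw [Matrix.mul_apply]
  refine ((Finset.abs_sum_le_sum_abs _ _).trans (Finset.sum_le_sum fun k _ => hterm k)).trans ?_
  rw [Finset.sum_add_distrib, Finset.sum_ite_eq', if_pos (Finset.mem_univ i), Finset.sum_const,
    Finset.card_univ, Fintype.card_fin, nsmul_eq_mul]
  rcases hij.eq_or_lt with rfl | hlt
  · simp
  · rw [if_pos hlt]
    obtain ⟨m, hm⟩ : ∃ m, (j : ℕ) - (i : ℕ) = m + 1 :=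
      Nat.exists_eq_succ_of_ne_zero (Nat.sub_ne_zero_of_lt hlt)
    rw [hm, Nat.add_sub_cancel]
    calc x ^ (m + 1) + d * (M * x ^ m) = x ^ m * (x + d * M) := by ring
      _ ≤ (x + d * M) ^ m * (x + d * M) := by
        gcongr
        exact le_add_of_nonneg_right (by positivity)
      _ = (x + d * M) ^ (m + 1) := (pow_succ _ _).symm

/-- Entries of a product of upper-triangular matrices with diagonal `±1` and entries bounded
by `M`. -/
theorem Matrix.abs_list_prod_apply_le_pow_of_upperTriangular {d : ℕ} {M : ℤ} (hd : 1 ≤ d)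
    (hM : 1 ≤ M) (L : List (Matrix (Fin d) (Fin d) ℤ))
    (hut : ∀ A ∈ L, ∀ i j : Fin d, j < i → A i j = 0)
    (hdiag : ∀ A ∈ L, ∀ i, |A i i| = 1) (hAM : ∀ A ∈ L, ∀ i j, |A i j| ≤ M) :
    (∀ i j : Fin d, j < i → L.prod i j = 0) ∧
      ∀ i j : Fin d, i ≤ j →
        |L.prod i j| ≤ (d * M * (L.length + 1)) ^ ((j : ℕ) - (i : ℕ)) := by
  have hdM : 1 ≤ (d : ℤ) * M := one_le_mul_of_one_le_of_one_le (by exact_mod_cast hd) hM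
  induction L with
  | nil =>
    refine ⟨fun i j hij => by simp [Matrix.one_apply_ne hij.ne'], fun i j _ => ?_⟩
    have hone : |(1 : Matrix (Fin d) (Fin d) ℤ) i j| ≤ 1 := by
      rw [Matrix.one_apply]
      split_ifs <;> simp
    simpa using hone.trans (one_le_pow₀ hdM)
  | cons A L ih =>
    simp only [List.forall_mem_cons] at hut hdiag hAM
    obtain ⟨hzero, hle⟩ := ih hut.2 hdiag.2 hAM.2
    rw [List.prod_cons]
    refine ⟨fun i j hij => Matrix.mul_apply_eq_zero_of_upperTriangular hut.1 hzero hij,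
      fun i j hij => ?_⟩
    have hx : 1 ≤ (d : ℤ) * M * (L.length + 1) := one_le_mul_of_one_le_of_one_le hdM (by lia)
    refine (Matrix.abs_mul_apply_le_pow_of_upperTriangular (by lia) hx hut.1 hdiag.1 hAM.1
      hzero hle hij).trans_eq ?_
    rw [List.length_cons]
    push_cast
    ring


/-- If `T` is a finite set of invertible upper-triangular integer matrices, then there is a
constant `C > 0` such that the `(i,j)`-entry of any product of `n ≥ 1` matrices from `T` is
bounded in absolute value by `C · n^(j−i)` for `i ≤ j`, and is `0` for `i > j`. -/
theorem upper_triangular_product_entries_poly_bound (d : ℕ) (hd : 1 ≤ d)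
    (T : Finset (Matrix (Fin d) (Fin d) ℤ))
    (hut : ∀ A ∈ T, ∀ i j : Fin d, j < i → A i j = 0)
    (hinvertible : ∀ A ∈ T, IsUnit A) :
    ∃ C : ℝ, 0 < C ∧ ∀ n : ℕ, 1 ≤ n → ∀ L : List (Matrix (Fin d) (Fin d) ℤ),
      L.length = n → (∀ A ∈ L, A ∈ T) → ∀ i j : Fin d,
        (i ≤ j → (|L.prod i j| : ℝ) ≤ C * (n : ℝ) ^ ((j : ℕ) - (i : ℕ))) ∧
        (j < i → L.prod i j = 0) := by
  obtain ⟨M, hM, hTM⟩ : ∃ M : ℤ, 1 ≤ M ∧ ∀ A ∈ T, ∀ i j, |A i j| ≤ M := by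
    refine ⟨1 + ∑ A ∈ T, ∑ i, ∑ j, |A i j|,
      le_add_of_nonneg_right (by positivity), fun A hA i j => ?_⟩
    calc |A i j| ≤ ∑ j, |A i j| :=
          Finset.single_le_sum (f := fun j => |A i j|) (fun _ _ => abs_nonneg _)
            (Finset.mem_univ j)
      _ ≤ ∑ i, ∑ j, |A i j| :=
          Finset.single_le_sum (f := fun i => ∑ j, |A i j|) (fun _ _ => by positivity)
            (Finset.mem_univ i)
      _ ≤ ∑ A ∈ T, ∑ i, ∑ j, |A i j| :=
          Finset.single_le_sum (f := fun A : Matrix (Fin d) (Fin d) ℤ => ∑ i, ∑ j, |A i j|)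
            (fun _ _ => by positivity) hA
      _ ≤ 1 + ∑ A ∈ T, ∑ i, ∑ j, |A i j| := le_add_of_nonneg_left zero_le_one
  have hMR : (1 : ℝ) ≤ M := by exact_mod_cast hM
  have hdR : (1 : ℝ) ≤ d := by exact_mod_cast hd
  have hdM : (1 : ℝ) ≤ d * M := one_le_mul_of_one_le_of_one_le hdR hMR
  refine ⟨(2 * (d * M)) ^ d, by positivity, fun n hn L hL hLT i j => ?_⟩
  obtain ⟨hzero, hle⟩ := Matrix.abs_list_prod_apply_le_pow_of_upperTriangular hd hM L
    (fun A hA => hut A (hLT A hA))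
    (fun A hA => Matrix.abs_diag_eq_one_of_isUnit_of_upperTriangular (hut A (hLT A hA))
      (hinvertible A (hLT A hA)))
    (fun A hA => hTM A (hLT A hA))
  refine ⟨fun hij => ?_, hzero i j⟩
  have hnR : (1 : ℝ) ≤ n := by exact_mod_cast hn
  have hbound : (|L.prod i j| : ℝ) ≤ (d * M * (n + 1)) ^ ((j : ℕ) - (i : ℕ)) := by
    have := hle i j hij
    rw [hL] at this
    exact_mod_cast this
  calc (|L.prod i j| : ℝ) ≤ (d * M * (n + 1)) ^ ((j : ℕ) - (i : ℕ)) := hbound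
    _ ≤ (2 * (d * M) * n) ^ ((j : ℕ) - (i : ℕ)) := by
      refine pow_le_pow_left₀ (by positivity) ?_ _
      nlinarith
    _ = (2 * (d * M)) ^ ((j : ℕ) - (i : ℕ)) * (n : ℝ) ^ ((j : ℕ) - (i : ℕ)) := mul_pow _ _ _
    _ ≤ (2 * (d * M)) ^ d * (n : ℝ) ^ ((j : ℕ) - (i : ℕ)) := by
      refine mul_le_mul_of_nonneg_right ?_ (by positivity)
      exact pow_le_pow_right₀ (by linarith) (by omega)
end

section
/- Let C and f be positive-valued nondecreasing functions on ℕ satisfying C(n) = C(⌊n/2⌋) + C(⌈n/2⌉) + f(n) for all n ≥ 2. If f(n) = O(n^h) for some real h with 0 ≤ h < 1, then C(n) = O(n). -/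
open Asymptotics Filter

/-- If `f n = O(n^h)` with `h < 1`, then `f` is summable along powers of two relative to `n`. -/
theorem summable_two_pow_div_of_isBigO_rpow {f : ℕ → ℝ} {h : ℝ} (hh1 : h < 1)
    (hf : f =O[atTop] fun n : ℕ => (n : ℝ) ^ h) :
    Summable fun k : ℕ => f (2 ^ k) / 2 ^ k := by
  have hpow : Tendsto (fun k : ℕ => 2 ^ k) atTop atTop :=
    tendsto_pow_atTop_atTop_of_one_lt one_lt_two
  have hgeom : Summable fun k : ℕ => ((2 : ℝ) ^ (h - 1)) ^ k :=
    summable_geometric_of_lt_one (by positivity)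
      (Real.rpow_lt_one_of_one_lt_of_neg one_lt_two (by linarith))
  refine summable_of_isBigO_nat hgeom ?_
  refine ((hf.comp_tendsto hpow).mul (isBigO_refl (fun k : ℕ => ((2 : ℝ) ^ k)⁻¹) atTop)).congr_right
    fun k => ?_
  simp only [Function.comp_apply, Nat.cast_pow, Nat.cast_ofNat]
  rw [Real.rpow_sub_one two_ne_zero, div_pow, div_eq_mul_inv, ← Real.rpow_natCast,
    ← Real.rpow_natCast, ← Real.rpow_mul zero_le_two, ← Real.rpow_mul zero_le_two, mul_comm h]

/-- Unrolling the recurrence along powers of two. -/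
theorem two_pow_div_eq_add_sum {C f : ℕ → ℝ}
    (hrec : ∀ n : ℕ, 2 ≤ n → C n = C (n / 2) + C ((n + 1) / 2) + f n) (k : ℕ) :
    C (2 ^ k) / 2 ^ k = C 1 + ∑ j ∈ Finset.range k, f (2 ^ (j + 1)) / 2 ^ (j + 1) := by
  induction k with
  | zero => simp
  | succ k ih =>
    have hpos : 0 < 2 ^ k := Nat.two_pow_pos k
    have hfloor : 2 ^ (k + 1) / 2 = 2 ^ k := by omega
    have hceil : (2 ^ (k + 1) + 1) / 2 = 2 ^ k := by omega
    rw [Finset.sum_range_succ, ← add_assoc, ← ih, hrec (2 ^ (k + 1)) (by omega), hfloor, hceil]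
    field_simp
    ring

/-- Master theorem, first case: if `C` and `f` are positive nondecreasing functions on `ℕ` with
`C n = C ⌊n/2⌋ + C ⌈n/2⌉ + f n` for `n ≥ 2`, and `f n = O(n^h)` for some `0 ≤ h < 1`,
then `C n = O(n)`. -/
theorem master_theorem_sublinear (C f : ℕ → ℝ)
    (hCpos : ∀ n, 0 < C n) (hfpos : ∀ n, 0 < f n)
    (hCmono : Monotone C) (hfmono : Monotone f)
    (hrec : ∀ n : ℕ, 2 ≤ n → C n = C (n / 2) + C ((n + 1) / 2) + f n)
    (h : ℝ) (hh0 : 0 ≤ h) (hh1 : h < 1)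
    (hf : f =O[atTop] fun n : ℕ => (n : ℝ) ^ h) :
    C =O[atTop] fun n : ℕ => (n : ℝ) := by
  have hsum := (summable_nat_add_iff 1).2 (summable_two_pow_div_of_isBigO_rpow hh1 hf)
  set M := C 1 + ∑' j : ℕ, f (2 ^ (j + 1)) / 2 ^ (j + 1)
  have hM (k : ℕ) : C (2 ^ k) ≤ M * 2 ^ k := by
    rw [← div_le_iff₀ (by positivity), two_pow_div_eq_add_sum hrec]
    refine add_le_add le_rfl ?_
    exact hsum.sum_le_tsum _ fun j _ => div_nonneg (hfpos _).le (by positivity)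
  have hMpos : 0 < M := by simpa using (hCpos 1).trans_le (hM 0)
  refine IsBigO.of_bound (2 * M) ?_
  filter_upwards [eventually_ge_atTop 1] with n hn
  have hlog : 2 ^ Nat.log 2 n ≤ n := Nat.pow_log_le_self 2 (by omega)
  rw [Real.norm_of_nonneg (hCpos n).le, Real.norm_of_nonneg n.cast_nonneg]
  calc C n ≤ C (2 ^ (Nat.log 2 n + 1)) := hCmono (Nat.lt_pow_succ_log_self one_lt_two n).le
    _ ≤ M * 2 ^ (Nat.log 2 n + 1) := hM _
    _ = 2 * M * (2 ^ Nat.log 2 n : ℕ) := by push_cast; ring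
    _ ≤ 2 * M * n := by gcongr
end
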